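/- Let N ≥ 1 and m ≥ 1 be natural numbers, let G be the additive group (ℤ/N³ℤ) × (ℤ/N³ℤ), and let A ⊆ G be the image of the box {−N,…,N} × {−N²,…,N²} ⊆ ℤ × ℤ under coordinatewise reduction modulo N³. Then the m-fold sumset mA := A + ⋯ + A satisfies |mA| = min(2mN + 1, N³) · min(2mN² + 1, N³). -/

import Mathlib

open scoped Pointwise

/-- The `m`-fold iterated sumset `mA = A + ⋯ + A` of a finite subset of an abelian group
(with `0A = {0}`). -/
def iterSum {G : Type*} [AddCommGroup G] [DecidableEq G] (A : Finset G) : ℕ → Finset G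
  | 0 => {0}
  | n + 1 => A + iterSum A n

lemma split_aux (a t p : ℤ) (ha : 0 ≤ a) (ht : 0 ≤ t) (h1 : -(a + t) ≤ p) (h2 : p ≤ a + t) :
    ∃ c d : ℤ, -a ≤ c ∧ c ≤ a ∧ -t ≤ d ∧ d ≤ t ∧ c + d = p :=
  ⟨max (-a) (min a p), p - max (-a) (min a p), by omega, by omega, by omega, by omega, by omega⟩

lemma iter_aux (M : ℕ) (a b : ℤ) (ha : 0 ≤ a) (hb : 0 ≤ b) (m : ℕ) :
    iterSum (((Finset.Icc (-a) a) ×ˢ (Finset.Icc (-b) b)).image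
            fun p : ℤ × ℤ => ((p.1 : ZMod M), (p.2 : ZMod M))) m =
    ((Finset.Icc (-(m * a)) (m * a)) ×ˢ (Finset.Icc (-(m * b)) (m * b))).image
            fun p : ℤ × ℤ => ((p.1 : ZMod M), (p.2 : ZMod M)) := by
  induction m with
  | zero => simp [iterSum]; rfl
  | succ m ih =>
    have h1 : (((m + 1 : ℕ) : ℤ) * a) = a + m * a := by push_cast; ring
    have h2 : (((m + 1 : ℕ) : ℤ) * b) = b + m * b := by push_cast; ring
    have h3 : 0 ≤ (m : ℤ) * a := by positivity
    have h4 : 0 ≤ (m : ℤ) * b := by positivity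
    rw [iterSum, ih, h1, h2]
    generalize (m : ℤ) * a = s at *
    generalize (m : ℤ) * b = t at *
    ext x
    simp only [Finset.mem_add, Finset.mem_image, Finset.mem_product, Finset.mem_Icc]
    constructor
    · rintro ⟨_, ⟨p, hp, rfl⟩, _, ⟨q, hq, rfl⟩, rfl⟩
      refine ⟨p + q, ?_, ?_⟩
      · simp only [Prod.fst_add, Prod.snd_add]; omega
      · simp
    · rintro ⟨p, ⟨⟨h5, h6⟩, h7, h8⟩, rfl⟩
      obtain ⟨c, d, k1, k2, k3, k4, k5⟩ := split_aux a s p.1 ha h3 h5 h6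
      obtain ⟨e, f, l1, l2, l3, l4, l5⟩ := split_aux b t p.2 hb h4 h7 h8
      refine ⟨_, ⟨(c, e), ⟨⟨k1, k2⟩, l1, l2⟩, rfl⟩, _, ⟨(d, f), ⟨⟨k3, k4⟩, l3, l4⟩, rfl⟩, ?_⟩
      simp [← k5, ← l5]

lemma card_aux (M k : ℕ) [NeZero M] :
    ((Finset.Icc (-(k : ℤ)) k).image fun z : ℤ => (z : ZMod M)).card = min (2 * k + 1) M := by
  rcases le_total (2 * k + 1) M with h | h
  · rw [min_eq_left h, Finset.card_image_of_injOn]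
    · rw [Int.card_Icc]; omega
    · intro x hx y hy hxy
      simp only [Finset.coe_Icc, Set.mem_Icc] at hx hy
      have h1 := (ZMod.intCast_eq_intCast_iff_dvd_sub x y M).1 hxy
      have := Int.eq_zero_of_abs_lt_dvd h1 (by rw [abs_lt]; omega)
      omega
  · rw [min_eq_right h]
    have : ((Finset.Icc (-(k : ℤ)) k).image fun z : ℤ => (z : ZMod M)) = Finset.univ := by
      ext x
      simp only [Finset.mem_image, Finset.mem_Icc, Finset.mem_univ, iff_true]
      have := ZMod.val_lt (x + (k : ZMod M))
      refine ⟨((x + (k : ZMod M)).val : ℤ) - k, by omega, ?_⟩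
      push_cast
      rw [ZMod.natCast_zmod_val]; ring
    rw [this, Finset.card_univ, ZMod.card]

/-- **Example 1.12** of Tao, "Inverse theorems for sets and measures of polynomial growth":
for `G = ℤ/N³ℤ × ℤ/N³ℤ` and `A` the image of the box `{−N,…,N} × {−N²,…,N²}`, the `m`-fold
sumset satisfies `|mA| = min(2mN + 1, N³) · min(2mN² + 1, N³)`. -/
theorem box_sumset_growth_in_torus :
    ∀ N m : ℕ, 1 ≤ N → 1 ≤ m →
      (iterSum
          (((Finset.Icc (-(N : ℤ)) (N : ℤ)) ×ˢ
              (Finset.Icc (-((N : ℤ) ^ 2)) ((N : ℤ) ^ 2))).image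
            fun p : ℤ × ℤ => ((p.1 : ZMod (N ^ 3)), (p.2 : ZMod (N ^ 3))))
          m).card =
        min (2 * m * N + 1) (N ^ 3) * min (2 * m * N ^ 2 + 1) (N ^ 3) := by
  intro N m hN _
  have : NeZero (N ^ 3) := ⟨by positivity⟩
  rw [iter_aux (N ^ 3) N (N ^ 2) (by positivity) (by positivity) m]
  have h1 := card_aux (N ^ 3) (m * N)
  have h2 := card_aux (N ^ 3) (m * N ^ 2)
  push_cast at h1 h2
  rw [mul_assoc, mul_assoc, ← h1, ← h2, ← Finset.card_product]
  congr 1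
  ext x
  simp only [Finset.mem_image, Finset.mem_product]
  constructor
  · rintro ⟨p, ⟨hp, hq⟩, rfl⟩
    exact ⟨⟨p.1, hp, rfl⟩, ⟨p.2, hq, rfl⟩⟩
  · rintro ⟨⟨p, hp, h⟩, ⟨q, hq, h'⟩⟩
    exact ⟨(p, q), ⟨hp, hq⟩, Prod.ext h h'⟩
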